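/- Discretization error of the biconjugate (Lemma 2.2(iii)): Let d ≥ 1. Let X ⊆ ℝ^d be nonempty with ‖x‖ ≤ Δ_X for all x ∈ X, let X_N ⊆ X be finite nonempty, and let f : ℝ^d → ℝ be L_f-Lipschitz on X. Let S ⊆ ℝ^d be nonempty with ‖s‖ ≤ √d·L_f for all s ∈ S, and let S_K ⊆ S be finite nonempty. Define the biconjugates f⋆⋆(x) := sup_{s∈S} (⟪s,x⟫ − f⋆(s)), where f⋆ is the LFT of f over X, and f^{**}(x) := max_{s∈S_K} (⟪s,x⟫ − f^*(s)), where f^* is the discrete LFT of f over X_N. Then for every x ∈ X_N, |f⋆⋆(x) − f^{**}(x)| ≤ (1+√d)·Δ_X·d_H(S, S_K) + (1+√d)·L_f·d_H(X, X_N). -/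

import Mathlib

open scoped RealInnerProductSpace

/-- One-sided Hausdorff distance `d_H(X, Y) = sup_{x ∈ X} inf_{y ∈ Y} ‖x − y‖`. -/
noncomputable def dH {E : Type*} [PseudoMetricSpace E] (X Y : Set E) : ℝ :=
  sSup ((fun x => Metric.infDist x Y) '' X)

/-- Every point of a bounded set `X` is within `dH X Y` of some point of a finite set `Y`. -/
theorem exists_dist_le_dH {E : Type*} [PseudoMetricSpace E] {X : Set E}
    (hX : Bornology.IsBounded X) {Y : Finset E} (hY : Y.Nonempty) {x : E} (hx : x ∈ X) :
    ∃ y ∈ Y, dist x y ≤ dH X (Y : Set E) := by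
  obtain ⟨y, hy, hxy⟩ := Y.finite_toSet.isCompact.exists_infDist_eq_dist hY x
  refine ⟨y, hy, ?_⟩
  rw [← hxy]
  refine le_csSup ?_ (Set.mem_image_of_mem _ hx)
  obtain ⟨C, hC⟩ := hX.subset_closedBall y
  refine ⟨C, ?_⟩
  rintro _ ⟨z, hz, rfl⟩
  exact (Metric.infDist_le_dist_of_mem hy).trans (hC hz)

/-- Lemma 2.2(iii): discretization error of the biconjugate. -/
theorem biconjugate_discretization_error {d : ℕ} (hd : 1 ≤ d)
    (X : Set (EuclideanSpace ℝ (Fin d))) (hXne : X.Nonempty)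
    (ΔX : ℝ) (hΔX : ∀ x ∈ X, ‖x‖ ≤ ΔX)
    (XN : Finset (EuclideanSpace ℝ (Fin d))) (hXNne : XN.Nonempty)
    (hXNsub : (XN : Set (EuclideanSpace ℝ (Fin d))) ⊆ X)
    (f : EuclideanSpace ℝ (Fin d) → ℝ) (Lf : ℝ)
    (hfLip : ∀ x ∈ X, ∀ y ∈ X, |f x - f y| ≤ Lf * ‖x - y‖)
    (S : Set (EuclideanSpace ℝ (Fin d))) (hSne : S.Nonempty)
    (hSb : ∀ s ∈ S, ‖s‖ ≤ Real.sqrt d * Lf)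
    (SK : Finset (EuclideanSpace ℝ (Fin d))) (hSKne : SK.Nonempty)
    (hSKsub : (SK : Set (EuclideanSpace ℝ (Fin d))) ⊆ S) :
    ∀ x ∈ XN,
      |sSup ((fun s => ⟪s, x⟫ - sSup ((fun y => ⟪s, y⟫ - f y) '' X)) '' S)
          - SK.sup' hSKne (fun s => ⟪s, x⟫ - XN.sup' hXNne (fun y => ⟪s, y⟫ - f y))| ≤
        (1 + Real.sqrt d) * ΔX * dH S (SK : Set (EuclideanSpace ℝ (Fin d)))
          + (1 + Real.sqrt d) * Lf * dH X (XN : Set (EuclideanSpace ℝ (Fin d))) := by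
  intro x hx
  have hxX : x ∈ X := hXNsub hx
  have hd1 : 1 ≤ Real.sqrt d := by
    rw [Real.one_le_sqrt]
    exact_mod_cast hd
  have hΔ : 0 ≤ ΔX := (norm_nonneg x).trans (hΔX x hxX)
  have hL : 0 ≤ Lf := by
    obtain ⟨s, hs⟩ := hSne
    exact nonneg_of_mul_nonneg_right ((norm_nonneg s).trans (hSb s hs)) (by linarith)
  have hXb : Bornology.IsBounded X := isBounded_iff_forall_norm_le.2 ⟨ΔX, hΔX⟩
  have hSb' : Bornology.IsBounded S := isBounded_iff_forall_norm_le.2 ⟨_, hSb⟩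
  have hDX : 0 ≤ dH X (XN : Set (EuclideanSpace ℝ (Fin d))) := by
    obtain ⟨y, -, h⟩ := exists_dist_le_dH hXb hXNne hxX
    exact dist_nonneg.trans h
  have hDS : 0 ≤ dH S (SK : Set (EuclideanSpace ℝ (Fin d))) := by
    obtain ⟨s, hs⟩ := hSne
    obtain ⟨y, -, h⟩ := exists_dist_le_dH hSb' hSKne hs
    exact dist_nonneg.trans h
  set DX := dH X (XN : Set (EuclideanSpace ℝ (Fin d)))
  set DS := dH S (SK : Set (EuclideanSpace ℝ (Fin d)))
  set F : EuclideanSpace ℝ (Fin d) → ℝ := fun s => sSup ((fun y => ⟪s, y⟫ - f y) '' X)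
  set G : EuclideanSpace ℝ (Fin d) → ℝ := fun s => XN.sup' hXNne (fun y => ⟪s, y⟫ - f y)
  have hpt : ∀ s ∈ S, ∀ y ∈ X, ⟪s, y⟫ - f y ≤ G s + (1 + Real.sqrt d) * Lf * DX := by
    intro s hs y hy
    obtain ⟨z, hz, hyz⟩ := exists_dist_le_dH hXb hXNne hy
    rw [dist_eq_norm] at hyz
    have h1 : ⟪s, z⟫ - f z ≤ G s := Finset.le_sup' (fun y => ⟪s, y⟫ - f y) hz
    have h2 : ⟪s, y⟫ - ⟪s, z⟫ ≤ Real.sqrt d * Lf * DX := by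
      rw [← inner_sub_right]
      refine (real_inner_le_norm _ _).trans ?_
      exact mul_le_mul (hSb s hs) hyz (norm_nonneg _) (by positivity)
    have h3 : f z - f y ≤ Lf * DX := by
      rw [norm_sub_rev] at hyz
      exact (le_abs_self _).trans ((hfLip z (hXNsub hz) y hy).trans
        (mul_le_mul_of_nonneg_left hyz hL))
    linarith
  have hFG : ∀ s ∈ S, F s ≤ G s + (1 + Real.sqrt d) * Lf * DX := by
    intro s hs
    refine csSup_le (hXne.image _) ?_
    rintro _ ⟨y, hy, rfl⟩
    exact hpt s hs y hy
  have hGF : ∀ s ∈ S, G s ≤ F s := by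
    intro s hs
    refine Finset.sup'_le _ _ fun y hy => le_csSup ?_ (Set.mem_image_of_mem _ (hXNsub hy))
    refine ⟨G s + (1 + Real.sqrt d) * Lf * DX, ?_⟩
    rintro _ ⟨y, hy, rfl⟩
    exact hpt s hs y hy
  have hinner : ∀ s t y : EuclideanSpace ℝ (Fin d), y ∈ X → ‖s - t‖ ≤ DS →
      ⟪s, y⟫ - ⟪t, y⟫ ≤ ΔX * DS := by
    intro s t y hy hst
    rw [← inner_sub_left, mul_comm]
    exact (real_inner_le_norm _ _).trans (mul_le_mul hst (hΔX y hy) (norm_nonneg _) hDS)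
  set B := SK.sup' hSKne (fun s => ⟪s, x⟫ - G s)
  have hup : ∀ s ∈ S, ⟪s, x⟫ - F s ≤ B + (1 + Real.sqrt d) * ΔX * DS := by
    intro s hs
    obtain ⟨t, ht, hst⟩ := exists_dist_le_dH hSb' hSKne hs
    rw [dist_eq_norm] at hst
    have h1 : ⟪t, x⟫ - G t ≤ B := Finset.le_sup' (fun s => ⟪s, x⟫ - G s) ht
    have h2 := hinner s t x hxX hst
    have h3 : G t ≤ G s + ΔX * DS := by
      refine Finset.sup'_le _ _ fun y hy => ?_
      have h4 : ⟪s, y⟫ - f y ≤ G s := Finset.le_sup' (fun y => ⟪s, y⟫ - f y) hy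
      rw [norm_sub_rev] at hst
      have h5 := hinner t s y (hXNsub hy) hst
      linarith
    have h6 := hGF s hs
    have h7 : 0 ≤ (Real.sqrt d - 1) * (ΔX * DS) :=
      mul_nonneg (by linarith) (mul_nonneg hΔ hDS)
    linarith
  have hle : sSup ((fun s => ⟪s, x⟫ - F s) '' S) ≤ B + (1 + Real.sqrt d) * ΔX * DS := by
    refine csSup_le (hSne.image _) ?_
    rintro _ ⟨s, hs, rfl⟩
    exact hup s hs
  have hge : B ≤ sSup ((fun s => ⟪s, x⟫ - F s) '' S) + (1 + Real.sqrt d) * Lf * DX := by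
    refine Finset.sup'_le _ _ fun s hs => ?_
    have hbdd : BddAbove ((fun s => ⟪s, x⟫ - F s) '' S) := by
      refine ⟨B + (1 + Real.sqrt d) * ΔX * DS, ?_⟩
      rintro _ ⟨s, hs, rfl⟩
      exact hup s hs
    have h1 : ⟪s, x⟫ - F s ≤ sSup ((fun s => ⟪s, x⟫ - F s) '' S) :=
      le_csSup hbdd (Set.mem_image_of_mem (fun s => ⟪s, x⟫ - F s) (hSKsub hs))
    have h2 := hFG s (hSKsub hs)
    linarith
  have hX0 : 0 ≤ (1 + Real.sqrt d) * Lf * DX := by positivity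
  have hS0 : 0 ≤ (1 + Real.sqrt d) * ΔX * DS := by positivity
  rw [abs_le]
  constructor <;> linarith
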